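/- In the High Message regime, the fluid model has a unique equilibrium s* ∈ S¹ (i.e., a unique point with F_i(s*) = 0 for all i ≥ 1), given by s*₁ = λ and s*_i = 0 for all i ≥ 2 (equivalently, P₀(s*) = 0). -/

import Mathlib

open MeasureTheory Filter Topology

/-- Weighted ℓ² norm: ‖x‖_w = sqrt(∑ |x_i|²/2^i). -/
noncomputable def wnorm (x : ℕ → ℝ) : ℝ :=
  Real.sqrt (∑' i : ℕ, |x i| ^ 2 / 2 ^ i)

/-- Membership in S¹: s ∈ [0,1]^{ℤ≥0}, s₀ = 1, nonincreasing, summable. -/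
def memS1 (s : ℕ → ℝ) : Prop :=
  s 0 = 1 ∧ (∀ i, 0 ≤ s i ∧ s i ≤ 1) ∧ (∀ i, s (i + 1) ≤ s i) ∧ Summable s

/-- The drift F of the fluid model associated with the function P₀. -/
noncomputable def drift (lam : ℝ) (P0 : (ℕ → ℝ) → ℝ) (s : ℕ → ℝ) : ℕ → ℝ
  | 0 => 0
  | 1 => lam * (1 - P0 s) + lam * (1 - s 1) * P0 s - (s 1 - s 2)
  | (i + 2) => lam * (s (i + 1) - s (i + 2)) * P0 s - (s (i + 2) - s (i + 3))

/-- A fluid solution: takes values in S¹ (in particular s₀(t) = 1), is continuous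
with respect to ‖·‖_w on [0,∞), and for a.e. t ≥ 0 each coordinate i ≥ 1 is
differentiable at t with derivative F_i(s(t)). -/
def IsFluidSolution (lam : ℝ) (P0 : (ℕ → ℝ) → ℝ) (s : ℝ → ℕ → ℝ) : Prop :=
  (∀ t, 0 ≤ t → memS1 (s t)) ∧
  (∀ t, 0 ≤ t → ∀ ε > (0 : ℝ), ∃ δ > (0 : ℝ), ∀ u, 0 ≤ u → |u - t| < δ →
      wnorm (fun i => s u i - s t i) < ε) ∧
  ∃ Z : Set ℝ, volume Z = 0 ∧
    ∀ t, 0 ≤ t → t ∉ Z → ∀ i, 1 ≤ i →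
      HasDerivAt (fun u => s u i) (drift lam P0 (s t) i) t

/-- P₀ in the High Memory regime. -/
noncomputable def P0HighMemory (lam mu : ℝ) (s : ℕ → ℝ) : ℝ :=
  max (1 - mu * (1 - s 1) / lam) 0

/-- P₀ in the High Message regime. -/
noncomputable def P0HighMessage (lam : ℝ) (s : ℕ → ℝ) : ℝ :=
  if s 1 = 1 then max (1 - (1 - s 2) / lam) 0 else 0

/-- P₀ in the Constrained regime (with the convention 0⁰ = 1). -/
noncomputable def P0Constrained (lam mu : ℝ) (c : ℕ) (s : ℕ → ℝ) : ℝ :=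
  (∑ k ∈ Finset.range (c + 1), (mu * (1 - s 1) / lam) ^ k)⁻¹

/-- At an equilibrium in S¹, summing the drift equations of all coordinates above `i` gives the
balance `s (i + 2) = lam * P0 s * s (i + 1)`. -/
theorem eq_mul_of_drift_eq_zero {lam : ℝ} {P0 : (ℕ → ℝ) → ℝ} {s : ℕ → ℝ} (hs : Summable s)
    (h : ∀ i, 1 ≤ i → drift lam P0 s i = 0) (i : ℕ) :
    s (i + 2) = lam * P0 s * s (i + 1) := by
  have hstep (k : ℕ) : s (k + 3) - lam * P0 s * s (k + 2) =
      s (k + 2) - lam * P0 s * s (k + 1) := by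
    have hk := h (k + 2) (by lia)
    simp only [drift] at hk
    linarith
  have hconst (n : ℕ) : s (n + 2) - lam * P0 s * s (n + 1) = s 2 - lam * P0 s * s 1 := by
    induction n with
    | zero => rfl
    | succ k ih => exact (hstep k).trans ih
  have h0 := hs.tendsto_atTop_zero
  have hlim : Tendsto (fun n => s (n + 2) - lam * P0 s * s (n + 1)) atTop (𝓝 0) := by
    simpa using ((tendsto_add_atTop_iff_nat 2).2 h0).sub
      (((tendsto_add_atTop_iff_nat 1).2 h0).const_mul (lam * P0 s))
  have hzero : s 2 - lam * P0 s * s 1 = 0 :=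
    tendsto_nhds_unique (by simp only [hconst, tendsto_const_nhds]) hlim
  linarith [hconst i]

/-- The first coordinate of an equilibrium in S¹ equals the arrival rate, whatever `P0` is. -/
theorem apply_one_eq_of_drift_eq_zero {lam : ℝ} {P0 : (ℕ → ℝ) → ℝ} {s : ℕ → ℝ}
    (hs : Summable s) (h : ∀ i, 1 ≤ i → drift lam P0 s i = 0) : s 1 = lam := by
  have h1 := h 1 le_rfl
  have h2 := eq_mul_of_drift_eq_zero hs h 0
  simp only [drift] at h1
  norm_num at h2
  linarith

/-- Unique equilibrium of the fluid model in the High Message regime: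
s*₁ = λ and s*_i = 0 for i ≥ 2 (equivalently, P₀(s*) = 0). -/
theorem equilibrium_highMessage (lam : ℝ) (hlam0 : 0 < lam) (hlam1 : lam < 1) :
    let sstar : ℕ → ℝ := fun i => if i = 0 then 1 else if i = 1 then lam else 0
    memS1 sstar ∧
    P0HighMessage lam sstar = 0 ∧
    (∀ i, 1 ≤ i → drift lam (P0HighMessage lam) sstar i = 0) ∧
    (∀ s : ℕ → ℝ, memS1 s →
      (∀ i, 1 ≤ i → drift lam (P0HighMessage lam) s i = 0) → s = sstar) := by
  intro sstar
  have hP : P0HighMessage lam sstar = 0 := by simp [P0HighMessage, sstar, hlam1.ne]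
  refine ⟨⟨rfl, fun i => ?_, fun i => ?_, ?_⟩, hP, fun i hi => ?_, fun s hs h => ?_⟩
  · rcases i with _ | _ | i <;> simp [sstar, hlam0.le, hlam1.le]
  · rcases i with _ | _ | i <;> simp [sstar, hlam0.le, hlam1.le]
  · refine summable_of_ne_finset_zero (s := Finset.range 2) fun i hi => ?_
    simp only [Finset.mem_range, not_lt] at hi
    simp [sstar, show i ≠ 0 by lia, show i ≠ 1 by lia]
  · rcases i with _ | _ | i
    · lia
    · simp [drift, hP, sstar]
    · simp [drift, hP, sstar]
  · obtain ⟨hs0, -, -, hsum⟩ := hs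
    have hs1 := apply_one_eq_of_drift_eq_zero hsum h
    have hPs : P0HighMessage lam s = 0 := by simp [P0HighMessage, hs1, hlam1.ne]
    funext i
    rcases i with _ | _ | i
    · simpa [sstar] using hs0
    · simpa [sstar] using hs1
    · simpa [sstar, hPs] using eq_mul_of_drift_eq_zero hsum h i
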